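/- Let 0 < δ < 1. There are constants c > 0 and C = C(δ) > 0 such that for all X ≥ 2: ∫_0^1 |S̃_2(α)|⁴ dα ≤ C X (log X)^c, and for all η with 0 < η ≤ 1, ∫_ℝ |S̃_2(α)|⁴ K_η(α) dα ≤ C η X (log X)^c. -/

import Mathlib

open scoped Classical
open MeasureTheory

noncomputable section

/-- `e x = exp(2πix)` -/
def e (x : ℝ) : ℂ := Complex.exp (2 * Real.pi * Complex.I * x)

/-- The exponential sum `S_k(α)` over primes `p` with `δX ≤ p^k ≤ X`. -/
def S (k δ X α : ℝ) : ℂ :=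
  ∑ p ∈ (Finset.range (⌈X⌉₊ + 1)).filter
      (fun p : ℕ => p.Prime ∧ δ * X ≤ (p : ℝ) ^ k ∧ (p : ℝ) ^ k ≤ X),
    (Real.log p : ℂ) * e ((p : ℝ) ^ k * α)

/-- The exponential sum `U_k(α)` over naturals `n` with `δX ≤ n^k ≤ X`. -/
def U (k δ X α : ℝ) : ℂ :=
  ∑ n ∈ (Finset.range (⌈X⌉₊ + 1)).filter
      (fun n : ℕ => δ * X ≤ (n : ℝ) ^ k ∧ (n : ℝ) ^ k ≤ X),
    e ((n : ℝ) ^ k * α)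

/-- The exponential integral `T_k(α)`. -/
def T (k δ X α : ℝ) : ℂ :=
  ∫ t in (δ * X) ^ (1 / k)..(X ^ (1 / k)), e (α * t ^ k)

/-- Chebyshev theta function. -/
def theta (x : ℝ) : ℝ :=
  ∑ p ∈ (Finset.range (⌊x⌋₊ + 1)).filter Nat.Prime, Real.log p

/-- The generalized Selberg integral `𝒥_k(X,h)`. -/
def selbergJ (k X h : ℝ) : ℝ :=
  ∫ x in X..(2 * X),
    (theta ((x + h) ^ (1 / k)) - theta (x ^ (1 / k)) -
      ((x + h) ^ (1 / k) - x ^ (1 / k))) ^ 2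

/-- `ψ(m,z) = 1` iff every prime factor of `m` is at least `z`. -/
def psi (m : ℕ) (z : ℝ) : ℝ :=
  if ∀ p : ℕ, p.Prime → p ∣ m → z ≤ (p : ℝ) then 1 else 0

/-- The function `z(p)` of Harman–Kumchev. -/
def zfun (X : ℝ) (p : ℕ) : ℝ :=
  if (p : ℝ) < X ^ ((1 : ℝ) / 7) then X ^ ((5 : ℝ) / 28) * (p : ℝ) ^ (-(1 : ℝ) / 2)
  else if (p : ℝ) ≤ X ^ ((3 : ℝ) / 14) then (p : ℝ)
  else X ^ ((5 : ℝ) / 14) * (p : ℝ)⁻¹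

/-- The Harman–Kumchev sieve weight `ρ(m)`. -/
def rho (X : ℝ) (m : ℕ) : ℝ :=
  psi m (X ^ ((5 : ℝ) / 42)) -
    ∑ p ∈ (Finset.range (⌈X ^ ((1 : ℝ) / 4)⌉₊ + 1)).filter
        (fun p : ℕ => p.Prime ∧ X ^ ((5 : ℝ) / 42) ≤ (p : ℝ) ∧ (p : ℝ) < X ^ ((1 : ℝ) / 4) ∧ p ∣ m),
      psi (m / p) (zfun X p)

/-- The sieved exponential sum `S̃_2(α)`. -/
def Stilde (δ X α : ℝ) : ℂ :=
  ∑ m ∈ (Finset.range (⌈X⌉₊ + 1)).filter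
      (fun m : ℕ => δ * X ≤ (m : ℝ) ^ 2 ∧ (m : ℝ) ^ 2 ≤ X),
    (rho X m : ℂ) * e ((m : ℝ) ^ 2 * α)

/-- The Fejér-type kernel `K_η(α)`. -/
def Kf (η α : ℝ) : ℝ :=
  if α = 0 then η ^ 2 else (Real.sin (Real.pi * α * η) / (Real.pi * α)) ^ 2


lemma e_add (x y : ℝ) : e (x + y) = e x * e y := by
  simp only [e, ← Complex.exp_add]
  push_cast
  ring_nf

lemma continuous_e : Continuous e := by
  unfold e
  fun_prop

lemma e_natCast (n : ℕ) : e n = 1 := by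
  have := Complex.exp_nat_mul_two_pi_mul_I n
  unfold e
  rw [← this]
  push_cast
  ring_nf

lemma e_intCast (n : ℤ) : e n = 1 := by
  have := Complex.exp_int_mul_two_pi_mul_I n
  unfold e
  rw [← this]
  push_cast
  ring_nf

lemma e_zero : e 0 = 1 := by simp [e]

lemma conj_e (x : ℝ) : (starRingEnd ℂ) (e x) = e (-x) := by
  have : (starRingEnd ℂ) 2 = 2 := Complex.conj_ofNat 2
  simp [e, ← Complex.exp_conj, this]

lemma integral_e_int_mul (n : ℤ) :
    ∫ α in (0 : ℝ)..1, e (n * α) = if n = 0 then 1 else 0 := by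
  split_ifs with h
  · simp [h, e_zero]
  · have hc : (2 * Real.pi * Complex.I * n : ℂ) ≠ 0 := by
      have : (n : ℂ) ≠ 0 := by exact_mod_cast h
      simp [Real.pi_ne_zero, this]
    have h1 : ∀ α : ℝ, e (n * α) = Complex.exp ((2 * Real.pi * Complex.I * n) * α) := by
      intro α
      unfold e
      push_cast
      ring_nf
    have h2 := e_intCast n
    simp only [h1, integral_exp_mul_complex hc]
    unfold e at h2
    push_cast at h2
    simp [h2]

/-- Parseval for a finite exponential sum whose frequencies may coincide. -/
lemma integral_norm_sq_sum {ι : Type*} (P : Finset ι) (b : ι → ℝ) (n : ι → ℕ) :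
    ∫ α in (0 : ℝ)..1, ‖∑ i ∈ P, (b i : ℂ) * e (n i * α)‖ ^ 2 =
      ∑ i ∈ P, ∑ j ∈ P, if n i = n j then b i * b j else 0 := by
  have key : ∀ α : ℝ, ((‖∑ i ∈ P, (b i : ℂ) * e (n i * α)‖ ^ 2 : ℝ) : ℂ) =
      ∑ i ∈ P, ∑ j ∈ P, (b i * b j : ℂ) * e (((n i - n j : ℤ) : ℝ) * α) := by
    intro α
    push_cast
    rw [← Complex.mul_conj', map_sum, Finset.sum_mul_sum]
    refine Finset.sum_congr rfl fun i _ => Finset.sum_congr rfl fun j _ => ?_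
    rw [map_mul, conj_e, Complex.conj_ofReal, sub_mul, sub_eq_add_neg, e_add]
    ring
  have hint : ∀ i j, IntervalIntegrable
      (fun α : ℝ => (b i * b j : ℂ) * e (((n i - n j : ℤ) : ℝ) * α)) volume 0 1 := by
    intro i j
    refine Continuous.intervalIntegrable ?_ _ _
    exact continuous_const.mul (continuous_e.comp (by fun_prop))
  have : ((∫ α in (0 : ℝ)..1, ‖∑ i ∈ P, (b i : ℂ) * e (n i * α)‖ ^ 2 : ℝ) : ℂ) =
      ((∑ i ∈ P, ∑ j ∈ P, if n i = n j then b i * b j else 0 : ℝ) : ℂ) := by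
    rw [← intervalIntegral.integral_ofReal]
    simp only [key]
    rw [intervalIntegral.integral_finsetSum fun i _ => by
      simpa only [Finset.sum_fn] using IntervalIntegrable.sum P fun j _ => hint i j]
    rw [Complex.ofReal_sum]
    refine Finset.sum_congr rfl fun i _ => ?_
    rw [Complex.ofReal_sum, intervalIntegral.integral_finsetSum fun j _ => hint i j]
    refine Finset.sum_congr rfl fun j _ => ?_
    rw [intervalIntegral.integral_const_mul, integral_e_int_mul]
    by_cases h : n i = n j
    · simp [h]
    · have : (n i - n j : ℤ) ≠ 0 := by omega
      simp [h, this]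
  exact_mod_cast this

/-- Quadruples from `A` with `m₁² + m₂² = m₃² + m₄²`. -/
def squareEnergy (A : Finset ℕ) : Finset ((ℕ × ℕ) × (ℕ × ℕ)) :=
  ((A ×ˢ A) ×ˢ (A ×ˢ A)).filter
    fun q => q.1.1 ^ 2 + q.1.2 ^ 2 = q.2.1 ^ 2 + q.2.2 ^ 2

/-- Quadruples in `[1, N]` with `ab = cd`. -/
def mulEnergy (N : ℕ) : Finset ((ℕ × ℕ) × (ℕ × ℕ)) :=
  ((Finset.Icc 1 N ×ˢ Finset.Icc 1 N) ×ˢ (Finset.Icc 1 N ×ˢ Finset.Icc 1 N)).filter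
    fun q => q.1.1 * q.1.2 = q.2.1 * q.2.2

lemma integral_norm_pow_four_le (A : Finset ℕ) (a : ℕ → ℝ) (B : ℝ)
    (hB : ∀ m ∈ A, |a m| ≤ B) :
    ∫ α in (0 : ℝ)..1, ‖∑ m ∈ A, (a m : ℂ) * e ((m : ℝ) ^ 2 * α)‖ ^ 4 ≤
      B ^ 4 * (squareEnergy A).card := by
  have hsq : ∀ α : ℝ, ‖∑ m ∈ A, (a m : ℂ) * e ((m : ℝ) ^ 2 * α)‖ ^ 4 =
      ‖∑ p ∈ A ×ˢ A, ((a p.1 * a p.2 : ℝ) : ℂ) *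
        e (((p.1 ^ 2 + p.2 ^ 2 : ℕ) : ℝ) * α)‖ ^ 2 := by
    intro α
    have : ∑ p ∈ A ×ˢ A, ((a p.1 * a p.2 : ℝ) : ℂ) *
        e (((p.1 ^ 2 + p.2 ^ 2 : ℕ) : ℝ) * α) =
        (∑ m ∈ A, (a m : ℂ) * e ((m : ℝ) ^ 2 * α)) ^ 2 := by
      rw [pow_two, Finset.sum_mul_sum, ← Finset.sum_product']
      refine Finset.sum_congr rfl fun p _ => ?_
      push_cast
      rw [add_mul, e_add]
      ring
    rw [this, norm_pow, ← pow_mul]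
  simp only [hsq]
  rw [integral_norm_sq_sum (A ×ˢ A) (fun p => a p.1 * a p.2) (fun p => p.1 ^ 2 + p.2 ^ 2),
    ← Finset.sum_product', squareEnergy, ← Finset.sum_filter, mul_comm, ← nsmul_eq_mul]
  refine Finset.sum_le_card_nsmul _ _ _ fun q hq => ?_
  simp only [Finset.mem_filter, Finset.mem_product] at hq
  obtain ⟨⟨⟨h1, h2⟩, h3, h4⟩, -⟩ := hq
  have hB0 : 0 ≤ B := (abs_nonneg _).trans (hB _ h1)
  calc a q.1.1 * a q.1.2 * (a q.2.1 * a q.2.2)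
      ≤ |a q.1.1 * a q.1.2 * (a q.2.1 * a q.2.2)| := le_abs_self _
    _ = |a q.1.1| * |a q.1.2| * (|a q.2.1| * |a q.2.2|) := by simp only [abs_mul]
    _ ≤ B * B * (B * B) := by
        gcongr <;> apply hB <;> assumption
    _ = B ^ 4 := by ring

lemma card_mulEnergy_le_sum (N : ℕ) :
    (mulEnergy N).card ≤ ∑ p ∈ Finset.Icc 1 N ×ˢ Finset.Icc 1 N, (N / max p.1 p.2) ^ 2 := by
  have hsub : mulEnergy N ⊆
      ((Finset.Icc 1 N ×ˢ Finset.Icc 1 N).sigma fun p =>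
        Finset.Icc 1 (N / max p.1 p.2) ×ˢ Finset.Icc 1 (N / max p.1 p.2)).image
      fun s => ((s.1.1 * s.2.1, s.1.2 * s.2.2), (s.1.2 * s.2.1, s.1.1 * s.2.2)) := by
    rintro ⟨⟨a, b⟩, c, d⟩ hq
    simp only [mulEnergy, Finset.mem_filter, Finset.mem_product, Finset.mem_Icc] at hq
    obtain ⟨⟨⟨⟨ha, haN⟩, hb, hbN⟩, ⟨hc, hcN⟩, hd, hdN⟩, habcd⟩ := hq
    obtain ⟨g, x, y, hg, hxy, rfl, rfl⟩ :=
      Nat.exists_coprime' (Nat.gcd_pos_of_pos_left c (by omega : 0 < a))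
    have hx : 0 < x := Nat.pos_of_mul_pos_right (by omega : 0 < x * g)
    have hy : 0 < y := Nat.pos_of_mul_pos_right (by omega : 0 < y * g)
    have hxb : x * b = y * d := Nat.eq_of_mul_eq_mul_left hg (by linarith)
    obtain ⟨h, rfl⟩ : y ∣ b := hxy.symm.dvd_of_dvd_mul_left (hxb ▸ dvd_mul_right y d)
    obtain rfl : x * h = d := Nat.eq_of_mul_eq_mul_left hy (by linarith)
    have hh : 0 < h := Nat.pos_of_mul_pos_left (by omega : 0 < x * h)
    have hm : 0 < max x y := lt_max_of_lt_left hx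
    refine Finset.mem_image.2 ⟨⟨(x, y), (g, h)⟩, ?_, rfl⟩
    simp only [Finset.mem_sigma, Finset.mem_product, Finset.mem_Icc, Nat.le_div_iff_mul_le hm]
    refine ⟨⟨⟨hx, ?_⟩, hy, ?_⟩, ⟨hg, ?_⟩, hh, ?_⟩
    · nlinarith
    · nlinarith
    · rcases max_cases x y with h | h <;> rw [h.1] <;> linarith
    · rcases max_cases x y with h | h <;> rw [h.1] <;> linarith
  refine (Finset.card_le_card hsub).trans (Finset.card_image_le.trans ?_)
  rw [Finset.card_sigma]
  refine (Finset.sum_le_sum fun p _ => ?_)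
  simp [pow_two]

lemma card_mulEnergy_le (N : ℕ) :
    ((mulEnergy N).card : ℝ) ≤ 2 * (N : ℝ) ^ 2 * (1 + Real.log N) := by
  have h1 : ∀ p ∈ Finset.Icc 1 N ×ˢ Finset.Icc 1 N,
      (((N / max p.1 p.2) ^ 2 : ℕ) : ℝ) ≤
        (if p.2 ≤ p.1 then ((N : ℝ) / p.1) ^ 2 else 0) +
        (if p.1 ≤ p.2 then ((N : ℝ) / p.2) ^ 2 else 0) := by
    rintro ⟨x, y⟩ -
    have hx : ((N / x : ℕ) : ℝ) ≤ (N : ℝ) / x := Nat.cast_div_le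
    have hy : ((N / y : ℕ) : ℝ) ≤ (N : ℝ) / y := Nat.cast_div_le
    push_cast
    rcases le_total x y with h | h
    · have : 0 ≤ (if y ≤ x then ((N : ℝ) / x) ^ 2 else 0) := by positivity
      simp only [max_eq_right h, h, if_true]
      have : ((N / y : ℕ) : ℝ) ^ 2 ≤ ((N : ℝ) / y) ^ 2 := by gcongr
      linarith
    · have : 0 ≤ (if x ≤ y then ((N : ℝ) / y) ^ 2 else 0) := by positivity
      simp only [max_eq_left h, h, if_true]
      have : ((N / x : ℕ) : ℝ) ^ 2 ≤ ((N : ℝ) / x) ^ 2 := by gcongr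
      linarith
  have h2 : ∑ x ∈ Finset.Icc 1 N, ∑ y ∈ Finset.Icc 1 N,
      (if y ≤ x then ((N : ℝ) / x) ^ 2 else 0) = (N : ℝ) ^ 2 * (harmonic N : ℝ) := by
    rw [harmonic_eq_sum_Icc]
    push_cast
    rw [Finset.mul_sum]
    refine Finset.sum_congr rfl fun x hx => ?_
    rw [Finset.mem_Icc] at hx
    have : (Finset.Icc 1 N).filter (fun y => y ≤ x) = Finset.Icc 1 x := by
      ext y
      simp only [Finset.mem_filter, Finset.mem_Icc]
      omega
    rw [← Finset.sum_filter, this, Finset.sum_const, Nat.card_Icc, nsmul_eq_mul]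
    have : (x : ℝ) ≠ 0 := by
      have : x ≠ 0 := by omega
      exact_mod_cast this
    simp only [Nat.add_sub_cancel]
    field_simp
  have h3 : ((mulEnergy N).card : ℝ) ≤ 2 * ((N : ℝ) ^ 2 * (harmonic N : ℝ)) := by
    calc ((mulEnergy N).card : ℝ)
        ≤ ((∑ p ∈ Finset.Icc 1 N ×ˢ Finset.Icc 1 N, (N / max p.1 p.2) ^ 2 : ℕ) : ℝ) := by
          exact_mod_cast card_mulEnergy_le_sum N
      _ ≤ ∑ p ∈ Finset.Icc 1 N ×ˢ Finset.Icc 1 N,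
          ((if p.2 ≤ p.1 then ((N : ℝ) / p.1) ^ 2 else 0) +
          (if p.1 ≤ p.2 then ((N : ℝ) / p.2) ^ 2 else 0)) := by
          rw [Nat.cast_sum]
          exact Finset.sum_le_sum h1
      _ = 2 * ((N : ℝ) ^ 2 * (harmonic N : ℝ)) := by
          rw [Finset.sum_add_distrib, Finset.sum_product, Finset.sum_product_right, h2]
          ring
  have := harmonic_le_one_add_log N
  have h4 : (0 : ℝ) ≤ (N : ℝ) ^ 2 := by positivity
  nlinarith [mul_le_mul_of_nonneg_left this h4]

lemma card_squareEnergy_le (A : Finset ℕ) (N : ℕ) (hA : A ⊆ Finset.Icc 1 N) :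
    (squareEnergy A).card ≤ 3 * (mulEnergy (2 * N)).card := by
  have hmem : ∀ q ∈ squareEnergy A, (1 ≤ q.1.1 ∧ q.1.1 ≤ N) ∧ (1 ≤ q.1.2 ∧ q.1.2 ≤ N) ∧
      (1 ≤ q.2.1 ∧ q.2.1 ≤ N) ∧ (1 ≤ q.2.2 ∧ q.2.2 ≤ N) ∧
      q.1.1 ^ 2 + q.1.2 ^ 2 = q.2.1 ^ 2 + q.2.2 ^ 2 := by
    intro q hq
    simp only [squareEnergy, Finset.mem_filter, Finset.mem_product] at hq
    obtain ⟨⟨⟨h1, h2⟩, h3, h4⟩, h⟩ := hq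
    exact ⟨by simpa using hA h1, by simpa using hA h2, by simpa using hA h3,
      by simpa using hA h4, h⟩
  have heq : ((squareEnergy A).filter fun q => q.1.1 = q.2.1).card ≤
      (mulEnergy (2 * N)).card := by
    refine Finset.card_le_card ?_
    rintro ⟨⟨a, b⟩, c, d⟩ hq
    rw [Finset.mem_filter] at hq
    obtain ⟨hq, hac⟩ := hq
    obtain ⟨ha, hb, hc, hd, h⟩ := hmem _ hq
    dsimp only at *
    subst hac
    obtain rfl : b = d := by
      have : b ^ 2 = d ^ 2 := by omega
      exact Nat.pow_left_injective two_ne_zero this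
    simp only [mulEnergy, Finset.mem_filter, Finset.mem_product, Finset.mem_Icc]
    exact ⟨by omega, trivial⟩
  have hgt : ((squareEnergy A).filter fun q => q.2.1 < q.1.1).card ≤
      (mulEnergy (2 * N)).card := by
    have hlt : ∀ q ∈ (squareEnergy A).filter fun q => q.2.1 < q.1.1, q.1.2 < q.2.2 := by
      intro q hq
      rw [Finset.mem_filter] at hq
      obtain ⟨hq, hac⟩ := hq
      obtain ⟨-, -, -, -, h⟩ := hmem _ hq
      by_contra! hbd
      nlinarith
    refine Finset.card_le_card_of_injOn
      (fun q => ((q.1.1 - q.2.1, q.1.1 + q.2.1), (q.2.2 - q.1.2, q.2.2 + q.1.2))) ?_ ?_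
    · intro q hq
      have hbd := hlt q hq
      rw [Finset.mem_coe, Finset.mem_filter] at hq
      obtain ⟨hq, hac⟩ := hq
      obtain ⟨ha, hb, hc, hd, h⟩ := hmem _ hq
      simp only [mulEnergy, Finset.coe_filter, Set.mem_ofPred_eq, Finset.mem_product,
        Finset.mem_Icc]
      refine ⟨by omega, ?_⟩
      zify [hac.le, hbd.le]
      zify at h
      linarith
    · rintro ⟨⟨a, b⟩, c, d⟩ hq ⟨⟨a', b'⟩, c', d'⟩ hq' heq
      have hbd := hlt _ hq
      have hbd' := hlt _ hq'
      have hac := (Finset.mem_filter.1 hq).2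
      have hac' := (Finset.mem_filter.1 hq').2
      simp only [Prod.mk.injEq] at *
      omega
  have hlt : ((squareEnergy A).filter fun q => q.1.1 < q.2.1).card ≤
      (mulEnergy (2 * N)).card := by
    refine le_trans (Finset.card_le_card_of_injOn Prod.swap ?_ Prod.swap_injective.injOn) hgt
    intro q hq
    simp only [squareEnergy, Finset.coe_filter, Finset.mem_filter, Set.mem_ofPred_eq,
      Finset.mem_product, Prod.fst_swap, Prod.snd_swap] at hq ⊢
    exact ⟨⟨hq.1.1.symm, hq.1.2.symm⟩, hq.2⟩
  have hun : squareEnergy A ⊆ ((squareEnergy A).filter fun q => q.1.1 = q.2.1) ∪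
      ((squareEnergy A).filter fun q => q.2.1 < q.1.1) ∪
      ((squareEnergy A).filter fun q => q.1.1 < q.2.1) := by
    intro q hq
    simp only [Finset.mem_union, Finset.mem_filter, hq, true_and]
    omega
  have h1 := Finset.card_le_card hun
  have h2 := Finset.card_union_le (((squareEnergy A).filter fun q => q.1.1 = q.2.1) ∪
      ((squareEnergy A).filter fun q => q.2.1 < q.1.1))
      ((squareEnergy A).filter fun q => q.1.1 < q.2.1)
  have h3 := Finset.card_union_le ((squareEnergy A).filter fun q => q.1.1 = q.2.1)
      ((squareEnergy A).filter fun q => q.2.1 < q.1.1)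
  omega

lemma card_squareEnergy_le_log (A : Finset ℕ) (X : ℝ) (hX : 2 ≤ X)
    (hA : ∀ m ∈ A, 1 ≤ m ∧ (m : ℝ) ^ 2 ≤ X) :
    ((squareEnergy A).card : ℝ) ≤ 96 * X * Real.log X := by
  set N := ⌊Real.sqrt X⌋₊ with hN
  have hX0 : 0 ≤ X := by linarith
  have hsub : A ⊆ Finset.Icc 1 N := by
    intro m hm
    obtain ⟨h1, h2⟩ := hA m hm
    rw [Finset.mem_Icc]
    exact ⟨h1, Nat.le_floor (Real.le_sqrt_of_sq_le h2)⟩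
  have hN1 : 1 ≤ N := Nat.le_floor (by
    rw [Nat.cast_one]
    exact Real.one_le_sqrt.2 (by linarith))
  have hN1' : (1 : ℝ) ≤ N := by exact_mod_cast hN1
  have hN2 : (N : ℝ) ^ 2 ≤ X := by
    have : (N : ℝ) ≤ Real.sqrt X := Nat.floor_le (Real.sqrt_nonneg X)
    calc (N : ℝ) ^ 2 ≤ Real.sqrt X ^ 2 := by gcongr
      _ = X := Real.sq_sqrt hX0
  have h1 : ((squareEnergy A).card : ℝ) ≤ 3 * (mulEnergy (2 * N)).card := by
    exact_mod_cast card_squareEnergy_le A N hsub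
  have h2 := card_mulEnergy_le (2 * N)
  push_cast at h2
  have hlogX : Real.log 2 ≤ Real.log X := Real.log_le_log (by norm_num) hX
  have hlog2 := Real.log_two_gt_d9
  have hNX : (N : ℝ) ≤ X := by nlinarith
  have h3 : Real.log (2 * N) ≤ 2 * Real.log X := by
    rw [Real.log_mul (by norm_num) (by positivity)]
    have := Real.log_le_log (by linarith) hNX
    linarith
  have h4 : 1 + Real.log (2 * N) ≤ 4 * Real.log X := by linarith
  have h5 : 2 * (2 * (N : ℝ)) ^ 2 * (1 + Real.log (2 * N)) ≤ 8 * X * (4 * Real.log X) := by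
    have : 0 ≤ 1 + Real.log (2 * N) := by
      have := Real.log_nonneg (show (1 : ℝ) ≤ 2 * N by linarith)
      linarith
    have h6 : 2 * (2 * (N : ℝ)) ^ 2 ≤ 8 * X := by linarith
    gcongr
  linarith

lemma two_pow_card_primeFactors_le {m : ℕ} (hm : m ≠ 0) : 2 ^ m.primeFactors.card ≤ m := by
  calc 2 ^ m.primeFactors.card ≤ ∏ p ∈ m.primeFactors, p :=
        Finset.pow_card_le_prod _ _ _ fun p hp => (Nat.prime_of_mem_primeFactors hp).two_le
    _ ≤ m := Nat.le_of_dvd (Nat.pos_of_ne_zero hm) (Nat.prod_primeFactors_dvd m)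

lemma psi_nonneg (m : ℕ) (z : ℝ) : 0 ≤ psi m z := by
  unfold psi
  split_ifs <;> norm_num

lemma psi_le_one (m : ℕ) (z : ℝ) : psi m z ≤ 1 := by
  unfold psi
  split_ifs <;> norm_num

lemma abs_rho_le (X : ℝ) (hX : 2 ≤ X) (m : ℕ) (hm : 1 ≤ m) (hmX : (m : ℝ) ^ 2 ≤ X) :
    |rho X m| ≤ 4 * Real.log X := by
  set P := (Finset.range (⌈X ^ ((1 : ℝ) / 4)⌉₊ + 1)).filter
        (fun p : ℕ => p.Prime ∧ X ^ ((5 : ℝ) / 42) ≤ (p : ℝ) ∧ (p : ℝ) < X ^ ((1 : ℝ) / 4) ∧ p ∣ m)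
    with hP
  have hcard : P.card ≤ m.primeFactors.card := by
    refine Finset.card_le_card fun p hp => ?_
    simp only [hP, Finset.mem_filter] at hp
    exact Nat.mem_primeFactors.2 ⟨hp.2.1, hp.2.2.2.2, by omega⟩
  have hsum : ∑ p ∈ P, psi (m / p) (zfun X p) ≤ m.primeFactors.card := by
    calc ∑ p ∈ P, psi (m / p) (zfun X p) ≤ P.card • (1 : ℝ) :=
          Finset.sum_le_card_nsmul _ _ _ fun p _ => psi_le_one _ _
      _ ≤ m.primeFactors.card := by simpa using hcard
  have hsum0 : 0 ≤ ∑ p ∈ P, psi (m / p) (zfun X p) :=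
    Finset.sum_nonneg fun p _ => psi_nonneg _ _
  have hm1 : (1 : ℝ) ≤ m := by exact_mod_cast hm
  have hlogm : Real.log m ≤ Real.log X := Real.log_le_log (by linarith) (by nlinarith)
  have hpow : (m.primeFactors.card : ℝ) * Real.log 2 ≤ Real.log m := by
    rw [← Real.log_pow]
    refine Real.log_le_log (by positivity) ?_
    exact_mod_cast two_pow_card_primeFactors_le (by omega : m ≠ 0)
  have hlogX : Real.log 2 ≤ Real.log X := Real.log_le_log (by norm_num) hX
  have hlog2 := Real.log_two_gt_d9
  have hcard0 : (0 : ℝ) ≤ m.primeFactors.card := by positivity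
  have hcardX : (m.primeFactors.card : ℝ) ≤ 2 * Real.log X := by nlinarith
  have h0 := psi_nonneg m (X ^ ((5 : ℝ) / 42))
  have h1 := psi_le_one m (X ^ ((5 : ℝ) / 42))
  have : rho X m = psi m (X ^ ((5 : ℝ) / 42)) - ∑ p ∈ P, psi (m / p) (zfun X p) := rfl
  rw [this, abs_le]
  constructor <;> linarith

lemma Kf_neg (η α : ℝ) : Kf η (-α) = Kf η α := by
  simp [Kf]

lemma Kf_le (η α : ℝ) (hη : 0 < η) : Kf η α ≤ 4 * η ^ 2 / (1 + η * |α|) ^ 2 := by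
  have h0 : 0 ≤ η * |α| := by positivity
  rw [le_div_iff₀ (by positivity)]
  have hk : 0 ≤ Kf η α := by unfold Kf; split_ifs <;> positivity
  rcases le_or_gt (η * |α|) 1 with h | h
  · have : Kf η α ≤ η ^ 2 := by
      unfold Kf
      split_ifs with hα
      · exact le_rfl
      · rw [sq_le_sq, abs_div, div_le_iff₀ (by positivity)]
        calc |Real.sin (Real.pi * α * η)| ≤ |Real.pi * α * η| := Real.abs_sin_le_abs
          _ = |η| * |Real.pi * α| := by rw [abs_mul, mul_comm]
    have h2 : (1 + η * |α|) ^ 2 ≤ 4 := by nlinarith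
    nlinarith [sq_nonneg η]
  · have hα : α ≠ 0 := by
      rintro rfl
      simp at h
      linarith
    have hα' : 0 < |α| := abs_pos.2 hα
    have h1 : Kf η α * |α| ^ 2 ≤ 1 := by
      have hs : Real.sin (Real.pi * α * η) ^ 2 ≤ 1 := Real.sin_sq_le_one _
      simp only [Kf, if_neg hα, sq_abs]
      rw [div_pow, div_mul_eq_mul_div, div_le_one (by positivity), mul_pow]
      have hpi : 1 ≤ Real.pi ^ 2 := by nlinarith [Real.pi_gt_three]
      nlinarith [sq_nonneg α, mul_nonneg (sub_nonneg.2 hpi) (sq_nonneg α),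
        mul_nonneg (sub_nonneg.2 hs) (sq_nonneg α)]
    have h2 : (1 + η * |α|) ^ 2 ≤ 4 * (η ^ 2 * |α| ^ 2) := by nlinarith
    calc Kf η α * (1 + η * |α|) ^ 2 ≤ Kf η α * (4 * (η ^ 2 * |α| ^ 2)) := by gcongr
      _ = 4 * η ^ 2 * (Kf η α * |α| ^ 2) := by ring
      _ ≤ 4 * η ^ 2 * 1 := by gcongr
      _ = 4 * η ^ 2 := mul_one _

lemma integral_zero_natCast_mul_Kf_le (f : ℝ → ℝ) (hf : Continuous f) (hf0 : ∀ x, 0 ≤ f x)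
    (hper : Function.Periodic f 1) (η : ℝ) (hη : 0 < η) (hη1 : η ≤ 1)
    (hint : Integrable fun α => f α * Kf η α) (n : ℕ) :
    ∫ α in (0 : ℝ)..n, f α * Kf η α ≤
      8 * η * (1 - 1 / (1 + η * n)) * ∫ α in (0 : ℝ)..1, f α := by
  have hI : 0 ≤ ∫ α in (0 : ℝ)..1, f α :=
    intervalIntegral.integral_nonneg zero_le_one fun x _ => hf0 x
  induction n with
  | zero => simp
  | succ n ih =>
    have hadd := intervalIntegral.integral_add_adjacent_intervals
      (hint.intervalIntegrable (a := 0) (b := n))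
      (hint.intervalIntegrable (a := n) (b := (n + 1 : ℕ)))
    have hstep : ∫ α in (n : ℝ)..(n + 1 : ℕ), f α * Kf η α ≤
        4 * η ^ 2 / (1 + η * n) ^ 2 * ∫ α in (0 : ℝ)..1, f α := by
      have hshift : ∫ α in (n : ℝ)..(n + 1 : ℕ), f α = ∫ α in (0 : ℝ)..1, f α := by
        have := hper.intervalIntegral_add_eq n 0
        simpa using this
      rw [← hshift, ← intervalIntegral.integral_const_mul]
      refine intervalIntegral.integral_mono_on (by simp) hint.intervalIntegrable
        ((continuous_const.mul hf).intervalIntegrable _ _) fun x hx => ?_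
      rw [mul_comm]
      refine mul_le_mul_of_nonneg_right ((Kf_le η x hη).trans ?_) (hf0 x)
      have : (n : ℝ) ≤ |x| := hx.1.trans (le_abs_self x)
      gcongr
    have hscal : 4 * η ^ 2 / (1 + η * n) ^ 2 ≤
        8 * η * (1 / (1 + η * n) - 1 / (1 + η * (n + 1 : ℕ))) := by
      have h0 : 0 ≤ η * n := by positivity
      push_cast
      have hd : 0 < 1 + η * (n : ℝ) := by positivity
      have hd' : 0 < 1 + η * ((n : ℝ) + 1) := by positivity
      rw [div_sub_div _ _ hd.ne' hd'.ne', ← mul_div_assoc,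
        div_le_div_iff₀ (by positivity) (by positivity)]
      have h1 : 1 + η * ((n : ℝ) + 1) ≤ 2 * (1 + η * n) := by linarith
      have := mul_le_mul_of_nonneg_left h1 (by positivity : 0 ≤ 4 * η ^ 2 * (1 + η * (n : ℝ)))
      linarith
    rw [← hadd]
    have := mul_le_mul_of_nonneg_right hscal hI
    linarith

lemma integral_mul_Kf_le (f : ℝ → ℝ) (hf : Continuous f) (hf0 : ∀ x, 0 ≤ f x)
    (hper : Function.Periodic f 1) (η : ℝ) (hη : 0 < η) (hη1 : η ≤ 1) :
    ∫ α : ℝ, f α * Kf η α ≤ 16 * η * ∫ α in (0 : ℝ)..1, f α := by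
  have hI : 0 ≤ ∫ α in (0 : ℝ)..1, f α :=
    intervalIntegral.integral_nonneg zero_le_one fun x _ => hf0 x
  by_cases hint : Integrable fun α => f α * Kf η α
  swap
  · rw [integral_undef hint]
    positivity
  have hlim := intervalIntegral_tendsto_integral hint
    (Filter.tendsto_neg_atTop_atBot.comp (tendsto_natCast_atTop_atTop (R := ℝ)))
    (tendsto_natCast_atTop_atTop (R := ℝ))
  refine le_of_tendsto' hlim fun n => ?_
  have hint' : Integrable fun α => f (-α) * Kf η α := by
    simpa only [Kf_neg] using hint.comp_neg
  have hper' : Function.Periodic (fun x => f (-x)) 1 := by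
    intro x
    have := hper (-(x + 1))
    simp only [← this]
    congr 1
    ring
  have hIneg : ∫ α in (0 : ℝ)..1, f (-α) = ∫ α in (0 : ℝ)..1, f α := by
    rw [intervalIntegral.integral_comp_neg (f := f)]
    have := hper.intervalIntegral_add_eq (-1) 0
    simpa using this
  have hscal : 8 * η * (1 - 1 / (1 + η * n)) ≤ 8 * η := by
    have : 0 ≤ 1 / (1 + η * (n : ℝ)) := by positivity
    nlinarith
  have hpos := (integral_zero_natCast_mul_Kf_le f hf hf0 hper η hη hη1 hint n).trans
    (mul_le_mul_of_nonneg_right hscal hI)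
  have hneg := (integral_zero_natCast_mul_Kf_le (fun x => f (-x)) (hf.comp continuous_neg)
    (fun x => hf0 _) hper' η hη hη1 hint' n).trans
    (mul_le_mul_of_nonneg_right hscal (hIneg ▸ hI))
  rw [hIneg] at hneg
  have hflip : ∫ α in (0 : ℝ)..n, f (-α) * Kf η α = ∫ α in (-n : ℝ)..0, f α * Kf η α := by
    have := intervalIntegral.integral_comp_neg (a := 0) (b := n) (f := fun α => f α * Kf η α)
    simpa only [Kf_neg, neg_zero] using this
  rw [hflip] at hneg
  have hadd := intervalIntegral.integral_add_adjacent_intervals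
    (hint.intervalIntegrable (a := (-n : ℝ)) (b := 0))
    (hint.intervalIntegrable (a := 0) (b := n))
  simp only [Function.comp_apply]
  rw [← hadd]
  linarith

lemma continuous_Stilde (δ X : ℝ) : Continuous (Stilde δ X) := by
  unfold Stilde
  exact continuous_finsetSum _ fun m _ =>
    continuous_const.mul (continuous_e.comp (continuous_const.mul continuous_id))

lemma Stilde_add_one (δ X α : ℝ) : Stilde δ X (α + 1) = Stilde δ X α := by
  unfold Stilde
  refine Finset.sum_congr rfl fun m _ => ?_
  have : e ((m : ℝ) ^ 2) = 1 := by exact_mod_cast e_natCast (m ^ 2)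
  rw [mul_add, e_add, mul_one, this, mul_one]

lemma integral_Stilde_pow_four_le (δ X : ℝ) (hδ : 0 < δ) (hX : 2 ≤ X) :
    ∫ α in (0 : ℝ)..1, ‖Stilde δ X α‖ ^ 4 ≤ 24576 * X * Real.log X ^ 5 := by
  have hlog : 0 ≤ Real.log X := Real.log_nonneg (by linarith)
  set A := (Finset.range (⌈X⌉₊ + 1)).filter
      (fun m : ℕ => δ * X ≤ (m : ℝ) ^ 2 ∧ (m : ℝ) ^ 2 ≤ X) with hA
  have hAm : ∀ m ∈ A, 1 ≤ m ∧ (m : ℝ) ^ 2 ≤ X := by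
    intro m hm
    simp only [hA, Finset.mem_filter] at hm
    refine ⟨Nat.one_le_iff_ne_zero.2 ?_, hm.2.2⟩
    rintro rfl
    have := hm.2.1
    have : 0 < δ * X := by positivity
    norm_num at *
    linarith
  calc ∫ α in (0 : ℝ)..1, ‖Stilde δ X α‖ ^ 4
      ≤ (4 * Real.log X) ^ 4 * (squareEnergy A).card :=
        integral_norm_pow_four_le A (rho X) _ fun m hm =>
          abs_rho_le X hX m (hAm m hm).1 (hAm m hm).2
    _ ≤ (4 * Real.log X) ^ 4 * (96 * X * Real.log X) := by
        gcongr
        exact card_squareEnergy_le_log A X hX hAm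
    _ = 24576 * X * Real.log X ^ 5 := by ring

theorem statement8 (δ : ℝ) (hδ0 : 0 < δ) (hδ1 : δ < 1) :
    ∃ c > (0 : ℝ), ∃ C > 0, ∀ X ≥ (2 : ℝ),
      (∫ α in (0 : ℝ)..1, ‖Stilde δ X α‖ ^ 4) ≤ C * X * (Real.log X) ^ c ∧
      ∀ η : ℝ, 0 < η → η ≤ 1 →
        (∫ α : ℝ, ‖Stilde δ X α‖ ^ 4 * Kf η α) ≤ C * η * X * (Real.log X) ^ c := by
  refine ⟨(5 : ℕ), by norm_num, 16 * 24576, by norm_num, fun X hX => ?_⟩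
  have hmean := integral_Stilde_pow_four_le δ X hδ0 hX
  have hlog : 0 ≤ Real.log X := Real.log_nonneg (by linarith)
  have hpos : 0 ≤ X * Real.log X ^ 5 := by positivity
  rw [Real.rpow_natCast]
  refine ⟨by linarith, fun η hη hη1 => ?_⟩
  have h := integral_mul_Kf_le (fun α => ‖Stilde δ X α‖ ^ 4)
    ((continuous_Stilde δ X).norm.pow 4) (fun _ => by positivity)
    (fun α => by simp only [Stilde_add_one]) η hη hη1
  have h16 : (0 : ℝ) ≤ 16 * η := by positivity
  have := mul_le_mul_of_nonneg_left hmean h16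
  linarith

end
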